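/- Let ω_1,…,ω_n be a gauge of a connection over ℝⁿ and x ∈ ℝⁿ. Then there exists a smooth gauge transformation a : ℝⁿ → GL_q(ℂ) with a(x) = I such that the transformed gauge ω'_k = a⁻¹ ω_k a + a⁻¹ ∂_k a is radial centered at x, i.e. Σ_{k=1}^n (z_k − x_k) ω'_k(z) = 0 for all z ∈ ℝⁿ; moreover ω'_k(x) = 0 for every k = 1, …, n. -/

import Mathlib

open MeasureTheory Set

noncomputable section

attribute [local instance] Matrix.frobeniusNormedAddCommGroup Matrix.frobeniusNormedRing
  Matrix.frobeniusNormedSpace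

/-- The algebra of `q × q` complex matrices, equipped (locally) with the Frobenius norm,
which is submultiplicative. -/
abbrev Mat (q : ℕ) := Matrix (Fin q) (Fin q) ℂ

/-- `ℝⁿ` with the Euclidean norm. -/
abbrev Euc (n : ℕ) := EuclideanSpace ℝ (Fin n)

/-- The partial derivative `∂ₖ f` of a matrix-valued map on `ℝⁿ`. -/
def pd {q n : ℕ} (f : Euc n → Mat q) (k : Fin n) (z : Euc n) : Mat q :=
  fderiv ℝ f z (EuclideanSpace.single k 1)

/-- The curvature components `Ω i j = ∂_i ω_j - ∂_j ω_i + [ω_i, ω_j]` of a gauge `ω`. -/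
def curv {q n : ℕ} (ω : Fin n → Euc n → Mat q) (i j : Fin n) (z : Euc n) : Mat q :=
  pd (ω j) i z - pd (ω i) j z + (ω i z * ω j z - ω j z * ω i z)

/-- The covariant derivative `∇ₖ Φ = ∂ₖ Φ + [ωₖ, Φ]`. -/
def covD {q n : ℕ} (ω : Fin n → Euc n → Mat q) (k : Fin n) (Φ : Euc n → Mat q) :
    Euc n → Mat q :=
  fun z => pd Φ k z + (ω k z * Φ z - Φ z * ω k z)

/-- The iterated covariant derivative `∇_μ Φ = ∇_{μ₁} ⋯ ∇_{μⱼ} Φ` for a tuple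
`μ = (μ₁, …, μⱼ)`, encoded as a list. -/
def covDIter {q n : ℕ} (ω : Fin n → Euc n → Mat q) (μ : List (Fin n))
    (Φ : Euc n → Mat q) : Euc n → Mat q :=
  μ.foldr (fun k Ψ => covD ω k Ψ) Φ

/-- The length `ℓ(γ) = ∫₀¹ |γ'(t)| dt` of a (Lipschitz) curve. -/
def len {n : ℕ} (γ : ℝ → Euc n) : ℝ := ∫ t in (0:ℝ)..1, ‖deriv γ t‖

/-- The integral `∫_{disk(γ)} α = ∫₀¹∫₀¹ s Σ_{i,j} α_{ij}(x + s(γ(t)-x)) (γᵢ(t)-xᵢ) γⱼ'(t) ds dt`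
of the two-form with components `α` over the radial disk of `γ` centered at `x`. -/
def diskInt {q n : ℕ} (α : Fin n → Fin n → Euc n → Mat q) (x : Euc n) (γ : ℝ → Euc n) :
    Mat q :=
  ∫ s in (0:ℝ)..1, ∫ t in (0:ℝ)..1,
    s • ∑ i, ∑ j, ((γ t i - x i) * deriv (fun u => γ u j) t) •
      α i j (x + s • (γ t - x))

/-- `a : [0,1] → M_q(ℂ)` solves (in integral form) the holonomy ODE
`a' = -(Σᵢ ωᵢ(γ(t)) γᵢ'(t)) a`, `a(0) = I`; the holonomy of `γ` is then `a 1`. -/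
def IsHolSol {q n : ℕ} (ω : Fin n → Euc n → Mat q) (γ : ℝ → Euc n) (a : ℝ → Mat q) : Prop :=
  Continuous a ∧ a 0 = 1 ∧ ∀ t ∈ Icc (0:ℝ) 1,
    a t = 1 - ∫ s in (0:ℝ)..t, (∑ i, deriv (fun u => γ u i) s • ω i (γ s)) * a s

/-- `γ` is a Lipschitz loop based at `x`. -/
def IsLoopAt {n : ℕ} (γ : ℝ → Euc n) (x : Euc n) : Prop :=
  (∃ K : NNReal, LipschitzOnWith K γ (Icc 0 1)) ∧ γ 0 = x ∧ γ 1 = x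

section CurryCompact

variable {K : Type} [TopologicalSpace K] [CompactSpace K]
  {P V F : Type} [TopologicalSpace P] [NormedAddCommGroup V] [NormedSpace ℝ V]
  [NormedAddCommGroup F] [NormedSpace ℝ F]

/-- A continuous family of continuous linear maps over a compact space, viewed as a continuous
linear map into the space of continuous functions. -/
def ContinuousMap.toCLM : C(K, V →L[ℝ] F) →L[ℝ] V →L[ℝ] C(K, F) :=
  LinearMap.mkContinuous₂
    (LinearMap.mk₂ ℝ (fun (A : C(K, V →L[ℝ] F)) (w : V) => (⟨fun k => A k w, by fun_prop⟩ : C(K, F)))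
      (fun A B w => by ext; simp) (fun c A w => by ext; simp)
      (fun A v w => by ext; simp) (fun c A w => by ext; simp)) 1
    (fun A w => (ContinuousMap.norm_le _ (by positivity)).2 fun k => by
      rw [one_mul]
      exact (A k).le_of_opNorm_le (A.norm_coe_le_norm k) w)

/-- A family of functions over a compact parameter space, jointly continuously differentiable in
the non-parameter variable, is differentiable as a map into the space of continuous functions. -/
lemma hasFDerivAt_curry {f : V → K → F} {f' : V → K → V →L[ℝ] F}
    (hf : ∀ v, Continuous (f v)) (hf' : Continuous fun p : V × K => f' p.1 p.2)
    (h : ∀ v k, HasFDerivAt (fun v => f v k) (f' v k) v) (v : V) :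
    HasFDerivAt (fun v => (⟨f v, hf v⟩ : C(K, F)))
      (ContinuousMap.toCLM (⟨f' v, by fun_prop⟩ : C(K, V →L[ℝ] F))) v := by
  have hg : Continuous fun v => (⟨f' v, by fun_prop⟩ : C(K, V →L[ℝ] F)) :=
    (ContinuousMap.curry ⟨fun p : V × K => f' p.1 p.2, hf'⟩).continuous
  rw [hasFDerivAt_iff_isLittleO, Asymptotics.isLittleO_iff]
  intro ε hε
  obtain ⟨δ, hδ, H⟩ := Metric.continuous_iff (β := C(K, V →L[ℝ] F)) |>.1 hg v ε hε
  filter_upwards [Metric.ball_mem_nhds v hδ] with w hw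
  refine (ContinuousMap.norm_le _ (by positivity)).2 fun k => ?_
  refine Convex.norm_image_sub_le_of_norm_hasFDerivWithin_le' (𝕜 := ℝ) (f := fun v => f v k)
    (f' := fun v => f' v k) (s := Metric.ball v δ)
    (fun y _ => (h y k).hasFDerivWithinAt) (fun y hy => ?_) (convex_ball v δ)
    (Metric.mem_ball_self hδ) hw
  have := (ContinuousMap.dist_le hε.le).1 (H y hy).le k
  rwa [dist_eq_norm] at this

end CurryCompact

/-- A smooth function of two variables, restricted to a compact interval in the second variable,
depends smoothly on the first variable in the supremum norm. -/
lemma contDiff_curry_Icc {V F : Type} [NormedAddCommGroup V] [NormedSpace ℝ V]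
    [NormedAddCommGroup F] [NormedSpace ℝ F] {f : V × ℝ → F} {n : ℕ} (hf : ContDiff ℝ n f)
    (a b : ℝ) :
    ContDiff ℝ n (fun v => (⟨fun t => f (v, t), by have := hf.continuous; fun_prop⟩ :
      C(Icc a b, F))) := by
  induction n generalizing F with
  | zero =>
    have hf' := hf.continuous
    exact contDiff_zero.2 (ContinuousMap.curry
      (⟨fun p : V × Icc a b => f (p.1, p.2), by fun_prop⟩ : C(V × Icc a b, F))).continuous
  | succ n ih =>
    push_cast at hf ⊢
    have hd : ContDiff ℝ n fun p : V × ℝ => (fderiv ℝ f p).comp (ContinuousLinearMap.inl ℝ V ℝ) :=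
      (hf.fderiv_right le_rfl).clm_comp contDiff_const
    have hdc := hd.continuous
    refine contDiff_succ_iff_hasFDerivAt.2 ⟨_, ContinuousMap.toCLM.contDiff.comp (ih hd), ?_⟩
    refine fun v => hasFDerivAt_curry (K := Icc a b) (f := fun v t => f (v, t))
      (f' := fun v t => (fderiv ℝ f (v, t)).comp (ContinuousLinearMap.inl ℝ V ℝ)) _
      (by fun_prop) (fun v t => ?_) v
    have h1 : HasFDerivAt f (fderiv ℝ f (v, t)) (v, (t : ℝ)) :=
      (hf.differentiable (by simp) _).hasFDerivAt
    exact h1.comp v (hasFDerivAt_prodMk_left v (t : ℝ))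

section LinearODE

variable {V E : Type} [NormedAddCommGroup V] [NormedSpace ℝ V]
  [NormedAddCommGroup E] [NormedSpace ℝ E]

local notation "𝕁" => Icc (0 : ℝ) 1

local notation "proj𝕁" => projIcc (0 : ℝ) 1 zero_le_one

/-- The primitive, vanishing at `0`, of a continuous function on the unit interval. -/
def primitiveCLM : C(𝕁, E) →L[ℝ] C(𝕁, E) :=
  LinearMap.mkContinuous
    { toFun := fun u => ⟨fun t => ∫ s in (0 : ℝ)..t, u (proj𝕁 s), by
        have : Continuous fun t : ℝ => ∫ s in (0 : ℝ)..t, u (proj𝕁 s) :=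
          intervalIntegral.continuous_primitive
            (fun a b => Continuous.intervalIntegrable (by fun_prop) a b) 0
        fun_prop⟩
      map_add' := fun u v => by
        ext t
        exact intervalIntegral.integral_add (Continuous.intervalIntegrable (by fun_prop) _ _)
          (Continuous.intervalIntegrable (by fun_prop) _ _)
      map_smul' := fun c u => by
        ext t
        exact intervalIntegral.integral_smul c _ } 1
    (fun u => (ContinuousMap.norm_le _ (by positivity)).2 fun t => by
      have h := intervalIntegral.norm_integral_le_of_norm_le_const (a := 0) (b := t) (C := ‖u‖)
        (f := fun s => u (proj𝕁 s)) (fun s _ => u.norm_coe_le_norm _)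
      refine h.trans ?_
      rw [sub_zero, abs_of_nonneg t.2.1, mul_comm]
      exact mul_le_mul_of_nonneg_right t.2.2 (norm_nonneg _))

/-- Pointwise application of a continuous family of operators over the unit interval. -/
def pointwiseCLM : C(𝕁, E →L[ℝ] E) →L[ℝ] C(𝕁, E) →L[ℝ] C(𝕁, E) :=
  LinearMap.mkContinuous₂
    (LinearMap.mk₂ ℝ (fun (A : C(𝕁, E →L[ℝ] E)) (u : C(𝕁, E)) =>
        (⟨fun t => A t (u t), by fun_prop⟩ : C(𝕁, E)))
      (fun A B w => by ext; simp) (fun c A w => by ext; simp)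
      (fun A v w => by ext; simp) (fun c A w => by ext; simp)) 1
    (fun A u => (ContinuousMap.norm_le _ (by positivity)).2 fun t => by
      rw [one_mul]
      exact (A t).le_of_opNorm_le_of_le (A.norm_coe_le_norm t) (u.norm_coe_le_norm t))

/-- The Volterra operator `u ↦ ∫₀ᵗ A(s) u(s) ds`. -/
def volterra (A : C(𝕁, E →L[ℝ] E)) : C(𝕁, E) →L[ℝ] C(𝕁, E) :=
  primitiveCLM.comp (pointwiseCLM A)

lemma volterra_apply (A : C(𝕁, E →L[ℝ] E)) (u : C(𝕁, E)) (t : 𝕁) :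
    volterra A u t = ∫ s in (0 : ℝ)..t, A (proj𝕁 s) (u (proj𝕁 s)) := rfl

lemma norm_volterra_pow_apply_le (A : C(𝕁, E →L[ℝ] E)) (u : C(𝕁, E)) (n : ℕ) (t : 𝕁) :
    ‖(volterra A ^ n) u t‖ ≤ ‖A‖ ^ n / n.factorial * ‖u‖ * (t : ℝ) ^ n := by
  induction n generalizing t with
  | zero => simpa using u.norm_coe_le_norm t
  | succ n ih =>
    rw [pow_succ', mul_apply_eq_comp, volterra_apply]
    refine (intervalIntegral.norm_integral_le_of_norm_le t.2.1
      (g := fun s => ‖A‖ * (‖A‖ ^ n / n.factorial * ‖u‖ * s ^ n)) (ae_of_all _ fun s hs => ?_)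
      (Continuous.intervalIntegrable (by fun_prop) _ _)).trans_eq ?_
    · have hs' : s ∈ 𝕁 := ⟨hs.1.le, hs.2.trans t.2.2⟩
      rw [projIcc_of_mem zero_le_one hs']
      exact (A ⟨s, hs'⟩).le_of_opNorm_le_of_le (A.norm_coe_le_norm _) (ih ⟨s, hs'⟩)
    · simp only [intervalIntegral.integral_const_mul, integral_pow]
      rw [Nat.factorial_succ]
      push_cast
      field_simp
      simp [pow_succ']
      ring

lemma isUnit_one_sub_volterra [CompleteSpace E] (A : C(𝕁, E →L[ℝ] E)) :
    IsUnit (1 - volterra A) := by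
  obtain ⟨n, hn⟩ := ((FloorSemiring.tendsto_pow_div_factorial_atTop ‖A‖).eventually
    (gt_mem_nhds one_pos)).exists
  have hlt : ‖volterra A ^ n‖ < 1 := by
    refine (ContinuousLinearMap.opNorm_le_bound _ (by positivity) fun u => ?_).trans_lt hn
    refine (ContinuousMap.norm_le _ (by positivity)).2 fun t => ?_
    refine (norm_volterra_pow_apply_le A u n t).trans ?_
    exact mul_le_of_le_one_right (by positivity) (pow_le_one₀ t.2.1 t.2.2)
  have hu := isUnit_one_sub_of_norm_lt_one (R := C(𝕁, E) →L[ℝ] C(𝕁, E)) hlt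
  rw [← mul_neg_geom_sum] at hu
  refine ((Commute.isUnit_mul_iff ?_).1 hu).1
  rw [commute_iff_eq, mul_neg_geom_sum, geom_sum_mul_neg]

/-- Smooth dependence on parameters of the solution of a linear ordinary differential equation,
in integral form. -/
theorem exists_contDiff_volterra_solution [CompleteSpace E] {B : V × ℝ → E →L[ℝ] E}
    (hB : ContDiff ℝ (⊤ : ℕ∞) B) (e : E) :
    ∃ b : V → C(𝕁, E), ContDiff ℝ (⊤ : ℕ∞) b ∧
      ∀ v, ∀ u : C(𝕁, E), u = b v ↔
        ∀ t : 𝕁, u t = e + ∫ s in (0 : ℝ)..t, B (v, proj𝕁 s) (u (proj𝕁 s)) := by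
  have hBc := hB.continuous
  let A : V → C(𝕁, E →L[ℝ] E) := fun v => ⟨fun t => B (v, t), by fun_prop⟩
  have hA : ContDiff ℝ (⊤ : ℕ∞) A :=
    contDiff_infty.2 fun n => contDiff_curry_Icc (contDiff_infty.1 hB n) 0 1
  have hP : ContDiff ℝ (⊤ : ℕ∞) fun v => pointwiseCLM (A v) :=
    have h : ContDiff ℝ (⊤ : ℕ∞) (pointwiseCLM (E := E)) := by fun_prop
    h.comp hA
  let T : V → C(𝕁, E) →L[ℝ] C(𝕁, E) := fun v => 1 - volterra (A v)
  have hT : ContDiff ℝ (⊤ : ℕ∞) T :=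
    contDiff_const.sub (contDiff_const.clm_comp hP)
  have hTu : ∀ v, IsUnit (T v) := fun v => isUnit_one_sub_volterra (A v)
  have hinv : ContDiff ℝ (⊤ : ℕ∞) fun v => Ring.inverse (T v) := by
    refine contDiff_iff_contDiffAt.2 fun v => ?_
    obtain ⟨w, hw⟩ := hTu v
    have := contDiffAt_ringInverse ℝ (R := C(𝕁, E) →L[ℝ] C(𝕁, E)) (n := (⊤ : ℕ∞)) w
    rw [hw] at this
    exact this.comp v hT.contDiffAt
  refine ⟨fun v => Ring.inverse (T v) (ContinuousMap.const _ e), hinv.clm_apply contDiff_const,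
    fun v u => ?_⟩
  have h1 : u = Ring.inverse (T v) (ContinuousMap.const _ e) ↔
      T v u = ContinuousMap.const _ e := by
    constructor
    · rintro rfl
      rw [← mul_apply_eq_comp, Ring.mul_inverse_cancel _ (hTu v)]
      rfl
    · intro h
      rw [← h, ← mul_apply_eq_comp, Ring.inverse_mul_cancel _ (hTu v)]
      rfl
  rw [h1, ContinuousMap.ext_iff]
  refine forall_congr' fun t => ?_
  change u t - volterra (A v) u t = e ↔ _
  rw [sub_eq_iff_eq_add]
  rfl

/-- A linear transport equation along the rays through the origin has a smooth solution. -/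
theorem exists_contDiff_radial_transport [CompleteSpace E] {β : V → V →L[ℝ] E →L[ℝ] E}
    (hβ : ContDiff ℝ (⊤ : ℕ∞) β) (e : E) :
    ∃ a : V → E, ContDiff ℝ (⊤ : ℕ∞) a ∧ a 0 = e ∧
      ∀ (v : V) (t : ℝ), fderiv ℝ a (t • v) v = β (t • v) v (a (t • v)) := by
  have hβc := hβ.continuous
  obtain ⟨b, hb, hbu⟩ := exists_contDiff_volterra_solution
    (B := fun p : V × ℝ => β (p.2 • p.1) p.1)
    ((hβ.comp (contDiff_snd.smul contDiff_fst)).clm_apply contDiff_fst) e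
  have hbs : ∀ v (t : 𝕁), b v t = e + ∫ s in (0 : ℝ)..t,
      β ((proj𝕁 s : ℝ) • v) v (b v (proj𝕁 s)) := fun v => (hbu v (b v)).1 rfl
  let a : V → E := fun v => b v 1
  have ha : ContDiff ℝ (⊤ : ℕ∞) a := (ContinuousLinearMap.contDiff (E := C(𝕁, E))
    (ContinuousMap.evalCLM ℝ (1 : 𝕁))).comp hb
  have hray : ∀ v (s : 𝕁), a ((s : ℝ) • v) = b v s := by
    intro v s
    let u : C(𝕁, E) := ⟨fun t => b v (s * t), by fun_prop⟩
    have hu : u = b ((s : ℝ) • v) := by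
      refine (hbu _ _).2 fun t => ?_
      change b v (s * t) = _
      rw [hbs]
      congr 1
      have := intervalIntegral.smul_integral_comp_mul_left (a := 0) (b := (t : ℝ))
        (fun r => β ((proj𝕁 r : ℝ) • v) v (b v (proj𝕁 r))) (s : ℝ)
      rw [mul_zero] at this
      rw [show ((s * t : 𝕁) : ℝ) = s * t from rfl, ← this, ← intervalIntegral.integral_smul]
      refine intervalIntegral.integral_congr fun r hr => ?_
      rw [uIcc_of_le t.2.1] at hr
      have hr' : r ∈ 𝕁 := ⟨hr.1, hr.2.trans t.2.2⟩
      have hsr : (s : ℝ) * r ∈ 𝕁 := (s * ⟨r, hr'⟩ : 𝕁).2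
      simp only [projIcc_of_mem zero_le_one hr', projIcc_of_mem zero_le_one hsr, map_smul,
        smul_apply, smul_smul, mul_comm r (s : ℝ)]
      rfl
    change b ((s : ℝ) • v) 1 = _
    rw [← hu]
    change b v (s * 1) = _
    rw [mul_one]
  have hderiv : ∀ v (s : 𝕁), fderiv ℝ a ((s : ℝ) • v) v = β ((s : ℝ) • v) v (a ((s : ℝ) • v)) := by
    intro v s
    have h1 : HasDerivWithinAt (fun t : ℝ => a (t • v)) (fderiv ℝ a ((s : ℝ) • v) v) 𝕁 s := by
      have h2 : HasDerivAt (fun t : ℝ => t • v) v (s : ℝ) := by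
        simpa using (hasDerivAt_id (s : ℝ)).smul_const v
      exact ((ha.differentiable (by simp) _).hasFDerivAt.comp_hasDerivAt (s : ℝ) h2).hasDerivWithinAt
    have h3 : HasDerivWithinAt (fun t : ℝ => a (t • v)) (β ((s : ℝ) • v) v (a ((s : ℝ) • v)))
        𝕁 s := by
      have hc : Continuous fun r : ℝ => β ((proj𝕁 r : ℝ) • v) v (b v (proj𝕁 r)) := by fun_prop
      have h4 := (intervalIntegral.integral_hasDerivAt_right (hc.intervalIntegrable 0 (s : ℝ))
        (hc.stronglyMeasurableAtFilter _ _) hc.continuousAt).const_add e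
      rw [projIcc_val zero_le_one s, ← hray] at h4
      refine h4.hasDerivWithinAt.congr_of_mem (fun t ht => ?_) s.2
      rw [hray v ⟨t, ht⟩, hbs]
    exact (uniqueDiffOn_Icc_zero_one s s.2).eq_deriv _ h1 h3
  refine ⟨a, ha, ?_, fun v t => ?_⟩
  · have := hray 0 0
    rw [smul_zero] at this
    rw [this, hbs]
    simp
  · rcases eq_or_ne t 0 with rfl | ht
    · simpa using hderiv v 0
    · have := hderiv (t • v) 1
      simp only [Icc.coe_one, one_smul, map_smul, smul_apply] at this
      exact smul_right_injective _ ht this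

end LinearODE

/-- Two maps which are transported along rays by opposite connection forms are inverse to each
other. -/
lemma radial_transport_mul_eq_one {V R : Type} [NormedAddCommGroup V] [NormedSpace ℝ V]
    [NormedRing R] [NormedAlgebra ℝ R] {a c : V → R} {η : V → V → R} (ha : Differentiable ℝ a)
    (hc : Differentiable ℝ c) (ha0 : a 0 = 1) (hc0 : c 0 = 1)
    (hda : ∀ (v : V) (t : ℝ), fderiv ℝ a (t • v) v = -(η (t • v) v * a (t • v)))
    (hdc : ∀ (v : V) (t : ℝ), fderiv ℝ c (t • v) v = c (t • v) * η (t • v) v) (v : V) :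
    c v * a v = 1 := by
  have hline : ∀ t : ℝ, HasDerivAt (fun t : ℝ => t • v) v t := fun t => by
    simpa using (hasDerivAt_id t).smul_const v
  have hd : ∀ t : ℝ, HasDerivAt (fun t : ℝ => c (t • v) * a (t • v)) 0 t := by
    intro t
    have h := ((hc _).hasFDerivAt.comp_hasDerivAt t (hline t)).mul
      ((ha _).hasFDerivAt.comp_hasDerivAt t (hline t))
    rw [hda, hdc] at h
    refine h.congr_deriv ?_
    simp [mul_assoc]
  have := is_const_of_deriv_eq_zero (fun t => (hd t).differentiableAt) (fun t => (hd t).deriv) 1 0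
  simpa [ha0, hc0] using this

section GaugeTransport

variable {n : ℕ} {R : Type} [NormedRing R] [NormedAlgebra ℝ R]

/-- The connection one-form at the point `x + v` of a gauge. -/
def gaugeForm (ω : Fin n → Euc n → R) (x v : Euc n) : Euc n →L[ℝ] R :=
  ∑ k, (EuclideanSpace.proj k : Euc n →L[ℝ] ℝ).smulRight (ω k (x + v))

lemma gaugeForm_apply (ω : Fin n → Euc n → R) (x v w : Euc n) :
    gaugeForm ω x v w = ∑ k, w k • ω k (x + v) := by
  simp [gaugeForm]

lemma contDiff_gaugeForm {ω : Fin n → Euc n → R} (hω : ∀ i, ContDiff ℝ (⊤ : ℕ∞) (ω i))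
    (x : Euc n) : ContDiff ℝ (⊤ : ℕ∞) (gaugeForm ω x) :=
  ContDiff.sum fun k _ => contDiff_const.smulRight
    ((hω k).comp (contDiff_const.add contDiff_id))

/-- A gauge transformation solving the parallel transport equation along all lines through `x`,
together with a left inverse. -/
theorem exists_gauge_transport [CompleteSpace R] {ω : Fin n → Euc n → R}
    (hω : ∀ i, ContDiff ℝ (⊤ : ℕ∞) (ω i)) (x : Euc n) :
    ∃ a c : Euc n → R, ContDiff ℝ (⊤ : ℕ∞) a ∧ (∀ v, c v * a v = 1) ∧ a 0 = 1 ∧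
      ∀ (v : Euc n) (t : ℝ),
        fderiv ℝ a (t • v) v = -((∑ k, v k • ω k (x + t • v)) * a (t • v)) := by
  have hg := contDiff_gaugeForm hω x
  obtain ⟨a, ha, ha0, hda⟩ := exists_contDiff_radial_transport
    (β := fun v => -((ContinuousLinearMap.mul ℝ R).comp (gaugeForm ω x v)))
    (contDiff_const.clm_comp hg).neg 1
  obtain ⟨c, hc, hc0, hdc⟩ := exists_contDiff_radial_transport
    (β := fun v => (ContinuousLinearMap.mul ℝ R).flip.comp (gaugeForm ω x v))
    (contDiff_const.clm_comp hg) 1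
  have hda' : ∀ (v : Euc n) (t : ℝ),
      fderiv ℝ a (t • v) v = -(gaugeForm ω x (t • v) v * a (t • v)) := hda
  refine ⟨a, c, ha, fun v => ?_, ha0, fun v t => ?_⟩
  · exact radial_transport_mul_eq_one (η := fun v w => gaugeForm ω x v w)
      (ha.differentiable (by simp)) (hc.differentiable (by simp)) ha0 hc0 hda' hdc v
  · rw [hda', gaugeForm_apply]

end GaugeTransport

/-- The matrix-valued case of `exists_gauge_transport`. -/
lemma exists_gauge_transport_matrix {q n : ℕ} {ω : Fin n → Euc n → Mat q}
    (hω : ∀ i, ContDiff ℝ (⊤ : ℕ∞) (ω i)) (x : Euc n) :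
    ∃ a c : Euc n → Mat q, ContDiff ℝ (⊤ : ℕ∞) a ∧ (∀ v, c v * a v = 1) ∧ a 0 = 1 ∧
      ∀ (v : Euc n) (t : ℝ),
        fderiv ℝ a (t • v) v = -((∑ k, v k • ω k (x + t • v)) * a (t • v)) := by
  have : CompleteSpace (Mat q) := FiniteDimensional.complete ℝ (Mat q)
  exact @exists_gauge_transport n (Mat q) _ Matrix.frobeniusNormedAlgebra this ω hω x

/-- Every gauge over `ℝⁿ` can be transformed, by a smooth gauge
transformation `a : ℝⁿ → GL_q(ℂ)` with `a(x) = I`, into a gauge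
`ω'ₖ = a⁻¹ ωₖ a + a⁻¹ ∂ₖ a` that is radial centered at `x`; moreover `ω'ₖ(x) = 0` for
every `k`. -/
theorem stmt8 (q n : ℕ) (hq : 1 ≤ q) (hn : 1 ≤ n)
    (ω : Fin n → Euc n → Mat q) (hω : ∀ i, ContDiff ℝ (⊤ : ℕ∞) (ω i))
    (x : Euc n) :
    ∃ a : Euc n → Mat q, ContDiff ℝ (⊤ : ℕ∞) a ∧ (∀ z, IsUnit (a z)) ∧ a x = 1 ∧
      (∀ z : Euc n, ∑ k, (z k - x k) •
        ((a z)⁻¹ * ω k z * a z + (a z)⁻¹ * pd a k z) = 0) ∧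
      (∀ k : Fin n, (a x)⁻¹ * ω k x * a x + (a x)⁻¹ * pd a k x = 0) := by
  obtain ⟨b, c, hb, hcb, hb0, hdb⟩ := exists_gauge_transport_matrix hω x
  have hpd : ∀ k z, pd (fun z => b (z - x)) k z =
      fderiv ℝ b (z - x) (EuclideanSpace.single k 1) := fun k z =>
    DFunLike.congr_fun (fderiv_comp_sub (f := b) x) _
  have hb0' : b (x - x) = 1 := by rw [sub_self, hb0]
  refine ⟨fun z => b (z - x), hb.comp (contDiff_id.sub contDiff_const),
    fun z => IsUnit.of_mul_eq_one_right _ (hcb (z - x)), hb0', fun z => ?_, fun k => ?_⟩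
  · have hsum : fderiv ℝ b (z - x) (z - x) =
        ∑ k, (z k - x k) • fderiv ℝ b (z - x) (EuclideanSpace.single k 1) := by
      conv_lhs =>
        enter [2]
        rw [← (EuclideanSpace.basisFun (Fin n) ℝ).sum_repr (z - x)]
      simp
    have h := hdb (z - x) 1
    simp only [one_smul, add_sub_cancel, PiLp.sub_apply] at h
    rw [hsum] at h
    simp only [hpd, mul_assoc, ← mul_add, ← mul_smul_comm, ← Finset.mul_sum]
    simp only [smul_add, Finset.sum_add_distrib, h, ← smul_mul_assoc, ← Finset.sum_mul]
    rw [add_neg_cancel, mul_zero]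
  · have h := hdb (EuclideanSpace.single k 1) 0
    simp only [zero_smul, add_zero, hb0, mul_one] at h
    simp only [hpd, sub_self, hb0, h]
    simp [PiLp.single_apply]

end
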